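/- Assume (E): Λ : ℤ^d → A is a colouring and (Q_j)_{j∈ℕ} a van Hove sequence such that for every box pattern P at the origin the frequency ν_P of P in Λ along (Q_j) exists. Let X be a Banach space and F : 𝓕 → X be Λ-invariant (with induced map F̃ on box patterns at the origin), almost-additive with boundary term b, and bounded with constant C. Then the limit lim_{M→∞} Σ_{P∈𝓟_M} ν_P F̃(P)/|C_M| exists in X and equals lim_{j→∞} F(Q_j)/|Q_j|. -/

import Mathlib

open Filter
noncomputable section

/-- `ℤ^d`. -/
abbrev Zd (d : ℕ) := Fin d → ℤ

namespace IDSZd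

variable {d : ℕ} {A : Type*} {X : Type*}

/-- The ℓ∞ (maximum) distance on `ℤ^d`, as a natural number. -/
def dInf (x y : Zd d) : ℕ := Finset.univ.sup fun j => (x j - y j).natAbs

/-- The closed ℓ∞-ball of radius `S` around `q`, as a finset. -/
def ball (q : Zd d) (S : ℕ) : Finset (Zd d) :=
  Fintype.piFinset fun j => Finset.Icc (q j - S) (q j + S)

open Classical in
/-- The `S`-boundary `∂^S Q` of a finite set `Q ⊆ ℤ^d`:  points outside `Q` within
distance `S` of `Q` together with points of `Q` within distance `S` of the complement. -/
def sBdry (S : ℕ) (Q : Finset (Zd d)) : Finset (Zd d) :=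
  ((Q.biUnion fun q => ball q S).filter fun x => x ∉ Q) ∪
    (Q.filter fun x => ∃ y : Zd d, y ∉ Q ∧ dInf x y ≤ S)

/-- A van Hove sequence of (nonempty) finite subsets of `ℤ^d`. -/
def VanHove (Q : ℕ → Finset (Zd d)) : Prop :=
  (∀ j, (Q j).Nonempty) ∧
    ∀ S : ℕ, Tendsto (fun j => ((sBdry S (Q j)).card : ℝ) / ((Q j).card : ℝ)) atTop (nhds 0)

/-- The translate `t + Q` of a finite set `Q ⊆ ℤ^d`. -/
def shift (t : Zd d) (Q : Finset (Zd d)) : Finset (Zd d) := Q.image (t + ·)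

/-- The box `C_M = {0, …, M−1}^d`. -/
def cube (d M : ℕ) : Finset (Zd d) := Fintype.piFinset fun _ => Finset.Ico (0 : ℤ) (M : ℤ)

/-- A box `[a₁,b₁] × ⋯ × [a_d,b_d]` in `ℤ^d`. -/
def IsBox (Q : Finset (Zd d)) : Prop :=
  ∃ a b : Zd d, (∀ j, a j ≤ b j) ∧ Q = Fintype.piFinset fun j => Finset.Icc (a j) (b j)

/-- A box at the origin, i.e. `[0,b₁] × ⋯ × [0,b_d]`. -/
def IsBoxAtOrigin (Q : Finset (Zd d)) : Prop :=
  ∃ b : Zd d, (∀ j, 0 ≤ b j) ∧ Q = Fintype.piFinset fun j => Finset.Icc 0 (b j)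

open Classical in
/-- The number of occurrences `♯_P P'` of the pattern `P` with domain `B` (given by a
total function) in the pattern `P'` with domain `Q` given by the total function `L`. -/
def occ (B : Finset (Zd d)) (P : Zd d → A) (Q : Finset (Zd d)) (L : Zd d → A) : ℕ :=
  (Q.filter fun x => shift x B ⊆ Q ∧ ∀ y ∈ B, L (x + y) = P y).card

/-- Extension of a pattern `P` with domain `B` to a total function on `ℤ^d`
(by a junk value taken from the colouring `Λ`). -/
def extPat (Λ : Zd d → A) (B : Finset (Zd d)) (P : ↥B → A) : Zd d → A :=
  fun y => if h : y ∈ B then P ⟨y, h⟩ else Λ 0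

/-- `ν` is the frequency function of the colouring `Λ` along the sequence `Q`:
for every box pattern at the origin the frequency exists and is given by `ν`. -/
def Freqs (Λ : Zd d → A) (Q : ℕ → Finset (Zd d)) (ν : Finset (Zd d) → (Zd d → A) → ℝ) : Prop :=
  ∀ B : Finset (Zd d), IsBoxAtOrigin B → ∀ P : Zd d → A,
    Tendsto (fun j => (occ B P (Q j) Λ : ℝ) / ((Q j).card : ℝ)) atTop (nhds (ν B P))

/-- A boundary term with constant `D`. -/
def IsBoundaryTerm (b : Finset (Zd d) → ℝ) (D : ℝ) : Prop :=
  (∀ Q, 0 ≤ b Q) ∧ (∀ t Q, b (shift t Q) = b Q) ∧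
    (∀ Q : ℕ → Finset (Zd d), VanHove Q →
      Tendsto (fun j => b (Q j) / ((Q j).card : ℝ)) atTop (nhds 0)) ∧
    0 < D ∧ ∀ Q : Finset (Zd d), b Q ≤ D * Q.card

section NormedX
variable [NormedAddCommGroup X]

/-- Almost additivity of `F` with boundary term `b`. -/
def AlmostAdditive (F : Finset (Zd d) → X) (b : Finset (Zd d) → ℝ) : Prop :=
  ∀ (m : ℕ) (Qs : Fin m → Finset (Zd d)), (∀ k l, k ≠ l → Disjoint (Qs k) (Qs l)) →
    ‖F (Finset.univ.biUnion Qs) - ∑ k, F (Qs k)‖ ≤ ∑ k, b (Qs k)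

/-- `Λ`-invariance of `F`. -/
def Invariant (Λ : Zd d → A) (F : Finset (Zd d) → X) : Prop :=
  ∀ (t : Zd d) (Q : Finset (Zd d)), (∀ y ∈ Q, Λ (t + y) = Λ y) → F (shift t Q) = F Q

/-- `Ft` is the map on box patterns at the origin (given by domain and total function,
depending only on the restriction of the function to the domain) induced by the
`Λ`-invariant map `F`. -/
def IsInducedMap (Λ : Zd d → A) (F : Finset (Zd d) → X)
    (Ft : Finset (Zd d) → (Zd d → A) → X) : Prop :=
  (∀ (B : Finset (Zd d)) (P P' : Zd d → A), (∀ y ∈ B, P y = P' y) → Ft B P = Ft B P') ∧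
    ∀ (t : Zd d) (Q : Finset (Zd d)), IsBoxAtOrigin Q →
      F (shift t Q) = Ft Q fun y => Λ (t + y)

/-- Boundedness of `F` with constant `C`. -/
def Bounded (F : Finset (Zd d) → X) (C : ℝ) : Prop := ∀ Q : Finset (Zd d), ‖F Q‖ ≤ C * Q.card

/-- The pattern average `Σ_{P ∈ 𝓟_M} ν_P F̃(P) / |C_M|`. -/
def patAvg [NormedSpace ℝ X] [Fintype A] (Λ : Zd d → A)
    (ν : Finset (Zd d) → (Zd d → A) → ℝ) (Ft : Finset (Zd d) → (Zd d → A) → X) (M : ℕ) : X :=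
  (((cube d M).card : ℝ))⁻¹ • ∑ P : ↥(cube d M) → A,
    ν (cube d M) (extPat Λ (cube d M) P) • Ft (cube d M) (extPat Λ (cube d M) P)

end NormedX

/-- The set of shifts `a` with `C_M(a) ∩ Q ≠ ∅`. -/
def coverShifts (Q : Finset (Zd d)) (M : ℕ) : Finset (Zd d) :=
  Q.biUnion fun q => Fintype.piFinset fun j => Finset.Ioc (q j - M) (q j)

/-- The set `D_{Q,x,M}` of lattice shifts `a ∈ x + (Mℤ)^d` whose box `C_M(a)` meets `Q`
but is not contained in `Q`. -/
def latticeD (Q : Finset (Zd d)) (x : Zd d) (M : ℕ) : Finset (Zd d) :=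
  (coverShifts Q M).filter fun a => (∀ j, (M : ℤ) ∣ (a j - x j)) ∧ ¬ shift a (cube d M) ⊆ Q

/-- The set `I_{Q,x,M}` of lattice shifts `a ∈ x + (Mℤ)^d` with `C_M(a) ⊆ Q` (for `M ≥ 1`). -/
def latticeI (Q : Finset (Zd d)) (x : Zd d) (M : ℕ) : Finset (Zd d) :=
  (coverShifts Q M).filter fun a => (∀ j, (M : ℤ) ∣ (a j - x j)) ∧ shift a (cube d M) ⊆ Q


section Helpers

open Classical in
lemma almostAdditive_finset {X : Type*} [NormedAddCommGroup X] {ι : Type*}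
    (F : Finset (Zd d) → X) (b : Finset (Zd d) → ℝ) (hAA : AlmostAdditive F b)
    (T : Finset ι) (f : ι → Finset (Zd d))
    (hf : ∀ k ∈ T, ∀ l ∈ T, k ≠ l → Disjoint (f k) (f l)) :
    ‖F (T.biUnion f) - ∑ k ∈ T, F (f k)‖ ≤ ∑ k ∈ T, b (f k) := by
  have e := T.equivFin
  have h := hAA T.card (fun k => f (e.symm k)) (fun k l hkl => hf _ (e.symm k).2 _ (e.symm l).2
    (fun h => hkl (e.symm.injective (Subtype.ext h))))
  have h1 : Finset.univ.biUnion (fun k => f (e.symm k)) = T.biUnion f := by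
    ext x
    simp only [Finset.mem_biUnion, Finset.mem_univ, true_and]
    constructor
    · rintro ⟨k, hk⟩
      exact ⟨_, (e.symm k).2, hk⟩
    · rintro ⟨k, hk, hx⟩
      exact ⟨e ⟨k, hk⟩, by simpa using hx⟩
  have h2 : ∑ k, F (f (e.symm k)) = ∑ k ∈ T, F (f k) := by
    rw [e.symm.sum_comp (fun k : T => F (f k))]
    exact Finset.sum_coe_sort T (fun k => F (f k))
  have h3 : ∑ k, b (f (e.symm k)) = ∑ k ∈ T, b (f k) := by
    rw [e.symm.sum_comp (fun k : T => b (f k))]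
    exact Finset.sum_coe_sort T (fun k => b (f k))
  have h1' : F (Finset.univ.biUnion (fun k => f (e.symm k))) = F (T.biUnion f) := by rw [h1]
  rw [h2, h3] at h
  convert h using 3
  rw [← h1']

lemma mem_cube {M : ℕ} {x : Zd d} : x ∈ cube d M ↔ ∀ j, 0 ≤ x j ∧ x j < M := by
  simp [cube]

lemma card_cube (M : ℕ) : (cube d M).card = M ^ d := by
  simp [cube]

lemma mem_shift {t x : Zd d} {Q : Finset (Zd d)} : x ∈ shift t Q ↔ x - t ∈ Q := by
  simp only [shift, Finset.mem_image]
  constructor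
  · rintro ⟨a, ha, rfl⟩
    simpa using ha
  · intro h
    exact ⟨_, h, by simp⟩

lemma mem_shift_cube {M : ℕ} {t x : Zd d} :
    x ∈ shift t (cube d M) ↔ ∀ j, t j ≤ x j ∧ x j < t j + M := by
  rw [mem_shift, mem_cube]
  refine forall_congr' fun j => ?_
  simp only [Pi.sub_apply]
  omega

lemma card_shift (t : Zd d) (Q : Finset (Zd d)) : (shift t Q).card = Q.card :=
  Finset.card_image_of_injective _ (add_right_injective t)

lemma dInf_le {x y : Zd d} {S : ℕ} : dInf x y ≤ S ↔ ∀ j, (x j - y j).natAbs ≤ S := by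
  simp [dInf, Finset.sup_le_iff]

lemma cube_isBox {M : ℕ} (hM : 0 < M) : IsBoxAtOrigin (cube d M) := by
  refine ⟨fun _ => (M : ℤ) - 1, fun _ => by show (0:ℤ) ≤ (M:ℤ) - 1; omega, ?_⟩
  ext x
  simp only [mem_cube, Fintype.mem_piFinset, Finset.mem_Icc]
  refine forall_congr' fun j => ?_
  omega

lemma mem_bdry_of_nonfull {M : ℕ} {a q : Zd d} {Q : Finset (Zd d)} (hq : q ∈ Q)
    (hqa : q ∈ shift a (cube d M)) (h : ¬ shift a (cube d M) ⊆ Q) : q ∈ sBdry M Q := by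
  obtain ⟨y, hy, hyQ⟩ := Finset.not_subset.1 h
  rw [mem_shift_cube] at hy hqa
  simp only [sBdry, Finset.mem_union, Finset.mem_filter]
  refine Or.inr ⟨hq, y, hyQ, dInf_le.2 fun j => ?_⟩
  have := hy j
  have := hqa j
  omega

open Classical in
/-- The estimate for one lattice shift `x`. -/
lemma one_shift {X : Type*} [NormedAddCommGroup X]
    (F : Finset (Zd d) → X) (b : Finset (Zd d) → ℝ) (D C : ℝ)
    (hb0 : ∀ Q, 0 ≤ b Q) (hbs : ∀ t Q, b (shift t Q) = b Q) (hD : 0 < D)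
    (hbD : ∀ Q : Finset (Zd d), b Q ≤ D * Q.card)
    (hAA : AlmostAdditive F b) (hC : 0 < C) (hBd : Bounded F C)
    {M : ℕ} (hM : 0 < M) (Q : Finset (Zd d)) (x : Zd d) (hx : x ∈ cube d M) :
    ‖F Q - ∑ a ∈ Q.filter (fun a => shift a (cube d M) ⊆ Q ∧ (fun j => a j % (M : ℤ)) = x),
        F (shift a (cube d M))‖ ≤
      b (cube d M) / (cube d M).card * Q.card + (C + D) * (sBdry M Q).card := by
  set g : Zd d → Zd d := fun q j => (q j - x j) / (M : ℤ) with hg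
  set a : Zd d → Zd d := fun r j => x j + M * r j with ha
  have hM' : (0 : ℤ) < M := by exact_mod_cast hM
  have hga : ∀ q r, g q = r ↔ q ∈ shift (a r) (cube d M) := by
    intro q r
    rw [mem_shift_cube, funext_iff]
    refine forall_congr' fun j => ?_
    simp only [hg, ha]
    rw [Int.ediv_eq_iff_of_pos hM']
    constructor <;> rintro ⟨h1, h2⟩ <;> constructor <;> nlinarith
  set T := Q.image g with hT
  set f : Zd d → Finset (Zd d) := fun r => Q.filter (fun q => g q = r) with hf
  have hU : T.biUnion f = Q := by
    ext q
    simp only [hT, hf, Finset.mem_biUnion, Finset.mem_image, Finset.mem_filter]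
    constructor
    · rintro ⟨r, -, h, -⟩; exact h
    · intro h; exact ⟨g q, ⟨q, h, rfl⟩, h, rfl⟩
  have hdis : ∀ k ∈ T, ∀ l ∈ T, k ≠ l → Disjoint (f k) (f l) := by
    intro k _ l _ hkl
    rw [Finset.disjoint_left]
    intro q hk hl
    simp only [hf, Finset.mem_filter] at hk hl
    exact hkl (hk.2.symm.trans hl.2)
  have h1 := almostAdditive_finset F b hAA T f hdis
  rw [hU] at h1
  set G : Zd d → X := fun r => if shift (a r) (cube d M) ⊆ Q then F (shift (a r) (cube d M)) else 0
    with hG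
  set β := b (cube d M) / (cube d M).card with hβ
  have hcpos : (0 : ℝ) < (cube d M).card := by
    rw [card_cube]; positivity
  have hβ0 : 0 ≤ β := div_nonneg (hb0 _) hcpos.le
  have hsum : ∑ a ∈ Q.filter (fun a => shift a (cube d M) ⊆ Q ∧ (fun j => a j % (M : ℤ)) = x),
        F (shift a (cube d M)) = ∑ r ∈ T, G r := by
    rw [hG, ← Finset.sum_filter]
    symm
    have hself : ∀ t : Zd d, t ∈ shift t (cube d M) := by
      intro t
      rw [mem_shift_cube]
      intro j; omega
    have hxc := mem_cube.1 hx
    refine Finset.sum_bij' (fun r _ => a r) (fun q _ => g q) ?_ ?_ ?_ ?_ ?_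
    · intro r hr
      simp only [Finset.mem_filter] at hr ⊢
      refine ⟨hr.2 (hself _), hr.2, ?_⟩
      funext j
      simp only [ha]
      rw [Int.add_mul_emod_self_left]
      exact Int.emod_eq_of_lt (hxc j).1 (hxc j).2
    · intro q hq
      simp only [Finset.mem_filter] at hq ⊢
      have : a (g q) = q := by
        funext j
        have := congrFun hq.2.2 j
        simp only [ha, hg]
        rw [Int.mul_ediv_cancel']
        · ring
        · rw [← this]
          exact Int.dvd_self_sub_emod
      rw [this]
      exact ⟨Finset.mem_image_of_mem _ hq.1, hq.2.1⟩
    · intro r hr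
      exact (hga _ _).2 (hself _)
    · intro q hq
      simp only [Finset.mem_filter] at hq
      funext j
      have := congrFun hq.2.2 j
      simp only [ha, hg]
      rw [Int.mul_ediv_cancel']
      · ring
      · rw [← this]
        exact Int.dvd_self_sub_emod
    · intro r hr; rfl
  rw [hsum]
  have hper : ∀ r ∈ T, b (f r) + ‖F (f r) - G r‖ ≤
      β * (f r).card + (C + D) * ((f r).filter (· ∈ sBdry M Q)).card := by
    intro r _
    by_cases hfull : shift (a r) (cube d M) ⊆ Q
    · have hfr : f r = shift (a r) (cube d M) := by
        ext q
        simp only [hf, Finset.mem_filter, hga]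
        exact ⟨fun h => h.2, fun h => ⟨hfull h, h⟩⟩
      have e1 : F (f r) - G r = 0 := by
        simp only [hG, if_pos hfull, hfr, sub_self]
      rw [e1, norm_zero, add_zero]
      have e2 : b (f r) = β * (f r).card := by
        rw [hfr, hbs, card_shift, hβ]
        field_simp
      rw [e2]
      have : 0 ≤ (C + D) * (((f r).filter (· ∈ sBdry M Q)).card : ℝ) := mul_nonneg (by linarith) (Nat.cast_nonneg _)
      linarith
    · have e0 : (f r).filter (· ∈ sBdry M Q) = f r := by
        refine Finset.filter_true_of_mem fun q hq => ?_
        simp only [hf, Finset.mem_filter, hga] at hq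
        exact mem_bdry_of_nonfull hq.1 hq.2 hfull
      rw [e0]
      simp only [hG, if_neg hfull, sub_zero]
      have := hBd (f r)
      have := hbD (f r)
      have : 0 ≤ β * ((f r).card : ℝ) := by positivity
      linarith
  have hcard1 : ∑ r ∈ T, ((f r).card : ℝ) = Q.card := by
    rw [← Nat.cast_sum, ← Finset.card_biUnion hdis, hU]
  have hcard2 : ∑ r ∈ T, (((f r).filter (· ∈ sBdry M Q)).card : ℝ) ≤ (sBdry M Q).card := by
    rw [← Nat.cast_sum, ← Finset.card_biUnion]
    · norm_cast
      apply Finset.card_le_card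
      intro q hq
      simp only [Finset.mem_biUnion, Finset.mem_filter] at hq
      obtain ⟨r, -, -, h⟩ := hq
      exact h
    · intro k hk l hl hkl
      exact Finset.disjoint_filter_filter (hdis k hk l hl hkl)
  calc ‖F Q - ∑ r ∈ T, G r‖
      = ‖(F Q - ∑ r ∈ T, F (f r)) + ∑ r ∈ T, (F (f r) - G r)‖ := by
        rw [Finset.sum_sub_distrib]; congr 1; abel
    _ ≤ ∑ r ∈ T, b (f r) + ∑ r ∈ T, ‖F (f r) - G r‖ :=
        (norm_add_le _ _).trans (add_le_add h1 (norm_sum_le _ _))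
    _ = ∑ r ∈ T, (b (f r) + ‖F (f r) - G r‖) := by rw [Finset.sum_add_distrib]
    _ ≤ ∑ r ∈ T, (β * (f r).card + (C + D) * ((f r).filter (· ∈ sBdry M Q)).card) :=
        Finset.sum_le_sum hper
    _ = β * Q.card + (C + D) * ∑ r ∈ T, (((f r).filter (· ∈ sBdry M Q)).card : ℝ) := by
        rw [Finset.sum_add_distrib, ← Finset.mul_sum, ← Finset.mul_sum, hcard1]
    _ ≤ _ := by gcongr

open Classical in
/-- Sum over all cubes contained in `Q` as a sum over patterns. -/
lemma sum_patterns {X : Type*} [NormedAddCommGroup X] [NormedSpace ℝ X] [Fintype A]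
    (Λ : Zd d → A) (F : Finset (Zd d) → X) (Ft : Finset (Zd d) → (Zd d → A) → X)
    (hFt : IsInducedMap Λ F Ft) {M : ℕ} (hM : 0 < M) (Q : Finset (Zd d)) :
    ∑ a ∈ Q.filter (fun a => shift a (cube d M) ⊆ Q), F (shift a (cube d M)) =
      ∑ P : ↥(cube d M) → A, (occ (cube d M) (extPat Λ (cube d M) P) Q Λ : ℝ) •
        Ft (cube d M) (extPat Λ (cube d M) P) := by
  rw [← Finset.sum_fiberwise _ (fun a => (fun y : ↥(cube d M) => Λ (a + y)))]
  refine Finset.sum_congr rfl fun P _ => ?_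
  have hiff : ∀ a : Zd d, (fun y : ↥(cube d M) => Λ (a + y)) = P ↔
      ∀ y ∈ cube d M, Λ (a + y) = extPat Λ (cube d M) P y := by
    intro a
    constructor
    · rintro h y hy
      rw [← h]
      simp [extPat, hy]
    · intro h
      funext y
      have := h y y.2
      simpa [extPat] using this
  have hocc : occ (cube d M) (extPat Λ (cube d M) P) Q Λ =
      ((Q.filter (fun a => shift a (cube d M) ⊆ Q)).filter
        (fun a => (fun y : ↥(cube d M) => Λ (a + y)) = P)).card := by
    rw [Finset.filter_filter, occ]
    congr 1
    apply Finset.filter_congr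
    intro a _
    rw [hiff]
  rw [hocc, Nat.cast_smul_eq_nsmul, ← Finset.sum_const]
  refine Finset.sum_congr rfl fun a ha => ?_
  rw [hFt.2 a _ (cube_isBox hM)]
  exact hFt.1 _ _ _ ((hiff a).1 (Finset.mem_filter.1 ha).2)

open Classical in
lemma key_estimate {X : Type*} [NormedAddCommGroup X] [NormedSpace ℝ X] [Fintype A]
    (Λ : Zd d → A) (F : Finset (Zd d) → X) (b : Finset (Zd d) → ℝ) (D C : ℝ)
    (hb0 : ∀ Q, 0 ≤ b Q) (hbs : ∀ t Q, b (shift t Q) = b Q) (hD : 0 < D)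
    (hbD : ∀ Q : Finset (Zd d), b Q ≤ D * Q.card)
    (hAA : AlmostAdditive F b) (hC : 0 < C) (hBd : Bounded F C)
    (Ft : Finset (Zd d) → (Zd d → A) → X) (hFt : IsInducedMap Λ F Ft)
    {M : ℕ} (hM : 0 < M) (Q : Finset (Zd d)) (hQ : Q.Nonempty) :
    ‖((Q.card : ℝ))⁻¹ • F Q - (((cube d M).card : ℝ))⁻¹ • ∑ P : ↥(cube d M) → A,
      ((occ (cube d M) (extPat Λ (cube d M) P) Q Λ : ℝ) / (Q.card : ℝ)) •
        Ft (cube d M) (extPat Λ (cube d M) P)‖ ≤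
      b (cube d M) / (cube d M).card + (C + D) * ((sBdry M Q).card / (Q.card : ℝ)) := by
  have hcpos : (0 : ℝ) < (cube d M).card := by
    rw [card_cube]; positivity
  have hqpos : (0 : ℝ) < Q.card := by exact_mod_cast hQ.card_pos
  have hM' : (0 : ℤ) < M := by exact_mod_cast hM
  have hfib := Finset.sum_fiberwise_of_maps_to
    (s := Q.filter (fun a => shift a (cube d M) ⊆ Q)) (t := cube d M)
    (g := fun a j => a j % (M : ℤ))
    (fun a _ => mem_cube.2 fun j => ⟨Int.emod_nonneg _ hM'.ne', Int.emod_lt_of_pos _ hM'⟩)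
    (fun a => F (shift a (cube d M)))
  simp only [Finset.filter_filter] at hfib
  have hs := hfib.trans (sum_patterns Λ F Ft hFt hM Q)
  have hbig : ‖((cube d M).card : ℝ) • F Q - ∑ P : ↥(cube d M) → A,
      (occ (cube d M) (extPat Λ (cube d M) P) Q Λ : ℝ) •
        Ft (cube d M) (extPat Λ (cube d M) P)‖ ≤
      (cube d M).card *
        (b (cube d M) / (cube d M).card * Q.card + (C + D) * (sBdry M Q).card) := by
    rw [← hs, Nat.cast_smul_eq_nsmul, ← Finset.sum_const, ← Finset.sum_sub_distrib,
      ← nsmul_eq_mul, ← Finset.sum_const]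
    exact (norm_sum_le _ _).trans (Finset.sum_le_sum fun x hx =>
      one_shift F b D C hb0 hbs hD hbD hAA hC hBd hM Q x hx)
  have hrew : ((Q.card : ℝ))⁻¹ • F Q - (((cube d M).card : ℝ))⁻¹ • ∑ P : ↥(cube d M) → A,
      ((occ (cube d M) (extPat Λ (cube d M) P) Q Λ : ℝ) / (Q.card : ℝ)) •
        Ft (cube d M) (extPat Λ (cube d M) P) =
      ((Q.card : ℝ)⁻¹ * ((cube d M).card : ℝ)⁻¹) •
      (((cube d M).card : ℝ) • F Q - ∑ P : ↥(cube d M) → A,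
      (occ (cube d M) (extPat Λ (cube d M) P) Q Λ : ℝ) •
        Ft (cube d M) (extPat Λ (cube d M) P)) := by
    rw [smul_sub, smul_smul, mul_assoc, inv_mul_cancel₀ hcpos.ne', mul_one, mul_comm, ← smul_smul,
      Finset.smul_sum (r := (Q.card : ℝ)⁻¹)]
    simp only [smul_smul, div_eq_inv_mul]
  rw [hrew, norm_smul, Real.norm_of_nonneg (by positivity)]
  refine (mul_le_mul_of_nonneg_left hbig (by positivity)).trans (le_of_eq ?_)
  field_simp

lemma card_bdry_cube (S M : ℕ) (h : 2 * S ≤ M) :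
    (sBdry S (cube d M)).card ≤ (M + 2 * S) ^ d - (M - 2 * S) ^ d := by
  set O : Finset (Zd d) := Fintype.piFinset fun _ => Finset.Ico (-(S : ℤ)) (M + S) with hO
  set I : Finset (Zd d) := Fintype.piFinset fun _ => Finset.Ico (S : ℤ) (M - S) with hI
  have hOc : O.card = (M + 2 * S) ^ d := by
    simp only [hO, Fintype.card_piFinset, Int.card_Ico, Finset.prod_const, Finset.card_univ,
      Fintype.card_fin]
    congr 1; omega
  have hIc : I.card = (M - 2 * S) ^ d := by
    simp only [hI, Fintype.card_piFinset, Int.card_Ico, Finset.prod_const, Finset.card_univ,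
      Fintype.card_fin]
    congr 1; omega
  have h_inner_sub : I ⊆ O := by
    intro x hx
    simp only [hI, hO, Fintype.mem_piFinset, Finset.mem_Ico] at hx ⊢
    intro j; have := hx j; omega
  rw [← hOc, ← hIc, ← Finset.card_sdiff_of_subset h_inner_sub]
  apply Finset.card_le_card
  intro x hx
  simp only [sBdry, Finset.mem_union, Finset.mem_filter, Finset.mem_biUnion, ball,
    Fintype.mem_piFinset, Finset.mem_Icc] at hx
  rw [Finset.mem_sdiff]
  simp only [hI, hO, Fintype.mem_piFinset, Finset.mem_Ico]
  rcases hx with ⟨⟨q, hq, hqx⟩, hxn⟩ | ⟨hx, y, hy, hxy⟩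
  · rw [mem_cube] at hq
    refine ⟨fun j => ?_, fun hc => hxn (mem_cube.2 fun j => ?_)⟩
    · have := hq j; have := hqx j; omega
    · have := hc j; omega
  · rw [mem_cube] at hx
    rw [dInf_le] at hxy
    refine ⟨fun j => ?_, fun hc => hy (mem_cube.2 fun j => ?_)⟩
    · have := hx j; omega
    · have := hc j; have := hxy j; omega

lemma vanHove_cubes : VanHove (fun M => cube d (M + 1)) := by
  refine ⟨fun M => ?_, fun S => ?_⟩
  · rw [← Finset.card_pos, card_cube]; positivity
  · have hlim : Tendsto (fun M : ℕ => (1 + 2 * (S : ℝ) / ((M : ℝ) + 1)) ^ d -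
        (1 - 2 * (S : ℝ) / ((M : ℝ) + 1)) ^ d) atTop (nhds 0) := by
      have h0 : Tendsto (fun M : ℕ => 2 * (S : ℝ) / ((M : ℝ) + 1)) atTop (nhds 0) :=
        Tendsto.const_div_atTop
          (tendsto_atTop_add_const_right _ _ tendsto_natCast_atTop_atTop) _
      have := ((h0.const_add 1).pow d).sub ((h0.const_sub 1).pow d)
      simpa using this
    refine squeeze_zero' (Eventually.of_forall fun M => by positivity) ?_ hlim
    filter_upwards [eventually_ge_atTop (2 * S)] with M hM
    have h1 := card_bdry_cube (d := d) S (M + 1) (by omega)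
    have h2 : ((sBdry S (cube d (M + 1))).card : ℝ) ≤
        ((M : ℝ) + 1 + 2 * S) ^ d - ((M : ℝ) + 1 - 2 * S) ^ d := by
      have h3 : (((M + 1 + 2 * S) ^ d - (M + 1 - 2 * S) ^ d : ℕ) : ℝ) =
          ((M : ℝ) + 1 + 2 * S) ^ d - ((M : ℝ) + 1 - 2 * S) ^ d := by
        rw [Nat.cast_sub (Nat.pow_le_pow_left (by omega) d), Nat.cast_pow, Nat.cast_pow,
          Nat.cast_sub (by omega)]
        push_cast
        ring
      rw [← h3]
      exact_mod_cast h1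
    rw [card_cube]
    have hp : (0 : ℝ) < (M : ℝ) + 1 := by positivity
    push_cast
    rw [div_le_iff₀ (by positivity), sub_mul, ← mul_pow, ← mul_pow]
    refine h2.trans (le_of_eq ?_)
    congr 2 <;> field_simp

end Helpers

/-- **Theorem (ergodic theorem, equality of the two limits):** under assumption (E),
for a `Λ`-invariant (with induced map `Ft` on box patterns at the origin), almost-additive,
bounded function `F`, the limit `lim_M Σ_{P∈𝓟_M} ν_P F̃(P)/|C_M|` exists and coincides with
`lim_j F(Q_j)/|Q_j|`. -/
theorem ergodic_limits_exist_and_agree {X : Type*} [NormedAddCommGroup X] [NormedSpace ℝ X]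
    [CompleteSpace X] [Fintype A]
    (hd : 1 ≤ d) (Λ : Zd d → A) (Qs : ℕ → Finset (Zd d)) (hvH : VanHove Qs)
    (ν : Finset (Zd d) → (Zd d → A) → ℝ) (hν : Freqs Λ Qs ν)
    (F : Finset (Zd d) → X) (b : Finset (Zd d) → ℝ) (D : ℝ) (hb : IsBoundaryTerm b D)
    (hInv : Invariant Λ F) (Ft : Finset (Zd d) → (Zd d → A) → X) (hFt : IsInducedMap Λ F Ft)
    (hAA : AlmostAdditive F b) (C : ℝ) (hCpos : 0 < C) (hBd : Bounded F C) :
    ∃ Fbar : X,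
      Filter.Tendsto (fun j => (((Qs j).card : ℝ))⁻¹ • F (Qs j)) Filter.atTop (nhds Fbar) ∧
      Filter.Tendsto (fun M => patAvg Λ ν Ft M) Filter.atTop (nhds Fbar) := by
  obtain ⟨hb0, hbs, hbv, hD, hbD⟩ := hb
  set u : ℕ → X := fun j => (((Qs j).card : ℝ))⁻¹ • F (Qs j) with hu
  set β : ℕ → ℝ := fun M => b (cube d (M + 1)) / ((cube d (M + 1)).card : ℝ) with hβdef
  have hβ : Tendsto β atTop (nhds 0) := hbv _ vanHove_cubes
  have hpat : ∀ M : ℕ, Tendsto (fun j => (((cube d (M + 1)).card : ℝ))⁻¹ •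
      ∑ P : ↥(cube d (M + 1)) → A,
      ((occ (cube d (M + 1)) (extPat Λ (cube d (M + 1)) P) (Qs j) Λ : ℝ) / ((Qs j).card : ℝ)) •
        Ft (cube d (M + 1)) (extPat Λ (cube d (M + 1)) P)) atTop
      (nhds (patAvg Λ ν Ft (M + 1))) := by
    intro M
    unfold patAvg
    refine Tendsto.const_smul (tendsto_finsetSum _ fun P _ => Tendsto.smul_const ?_ _) _
    exact hν _ (cube_isBox (Nat.succ_pos M)) _
  have hlim1 : ∀ M : ℕ, Tendsto (fun j => β M +
      (C + D) * ((sBdry (M + 1) (Qs j)).card / ((Qs j).card : ℝ)) +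
      ‖(((cube d (M + 1)).card : ℝ))⁻¹ • ∑ P : ↥(cube d (M + 1)) → A,
      ((occ (cube d (M + 1)) (extPat Λ (cube d (M + 1)) P) (Qs j) Λ : ℝ) / ((Qs j).card : ℝ)) •
        Ft (cube d (M + 1)) (extPat Λ (cube d (M + 1)) P) - patAvg Λ ν Ft (M + 1)‖)
      atTop (nhds (β M)) := by
    intro M
    have h1 := ((hvH.2 (M + 1)).const_mul (C + D)).const_add (β M)
    have h2 := ((hpat M).sub_const (patAvg Λ ν Ft (M + 1))).norm
    simpa using h1.add h2
  have hest : ∀ M j, ‖u j - patAvg Λ ν Ft (M + 1)‖ ≤ β M +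
      (C + D) * ((sBdry (M + 1) (Qs j)).card / ((Qs j).card : ℝ)) +
      ‖(((cube d (M + 1)).card : ℝ))⁻¹ • ∑ P : ↥(cube d (M + 1)) → A,
      ((occ (cube d (M + 1)) (extPat Λ (cube d (M + 1)) P) (Qs j) Λ : ℝ) / ((Qs j).card : ℝ)) •
        Ft (cube d (M + 1)) (extPat Λ (cube d (M + 1)) P) - patAvg Λ ν Ft (M + 1)‖ := by
    intro M j
    refine (norm_sub_le_norm_sub_add_norm_sub _ _ _).trans (add_le_add ?_ le_rfl)
    exact key_estimate Λ F b D C hb0 hbs hD hbD hAA hCpos hBd Ft hFt (Nat.succ_pos M) (Qs j)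
      (hvH.1 j)
  have hcau : CauchySeq u := by
    rw [Metric.cauchySeq_iff]
    intro ε hε
    obtain ⟨M, hMε⟩ := (hβ.eventually_lt_const (half_pos hε)).exists
    obtain ⟨N, hN⟩ := eventually_atTop.1 ((hlim1 M).eventually_lt_const hMε)
    refine ⟨N, fun m hm n hn => ?_⟩
    have h1 := (hest M m).trans_lt (hN m hm)
    have h2 := (hest M n).trans_lt (hN n hn)
    rw [← dist_eq_norm] at h1 h2
    have := dist_triangle_right (u m) (u n) (patAvg Λ ν Ft (M + 1))
    linarith
  obtain ⟨U, hU⟩ := cauchySeq_tendsto_of_complete hcau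
  refine ⟨U, hU, ?_⟩
  rw [← tendsto_add_atTop_iff_nat 1]
  have hle : ∀ M, dist (patAvg Λ ν Ft (M + 1)) U ≤ β M := by
    intro M
    rw [dist_comm, dist_eq_norm]
    exact le_of_tendsto_of_tendsto' (hU.sub_const _).norm (hlim1 M) (hest M)
  rw [tendsto_iff_dist_tendsto_zero]
  exact squeeze_zero (fun _ => dist_nonneg) hle hβ

end IDSZd
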